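/- arXiv:1311.4442 — 3 statements merged into one kernel-verified Lean document; each statement's English description precedes it below -/
import Mathlib

section
/- For every a > 0, every real x and every natural number j, one has (1/(2π)) ∫_ℝ (−iλ)^j e^{−λ²a} e^{iλx} dλ = (e^{−x²/(4a)} / (2√(πa))) · (1/(2√a)^j) · H_j(x/(2√a)), where the left-hand side is a complex integral and H_j is the j-th physicists' Hermite polynomial. -/
open Real MeasureTheory

/-- The physicists' Hermite polynomial `H_j(z) = (-1)^j e^{z²} (d^j/dz^j) e^{-z²}`. -/
noncomputable def hermiteH (j : ℕ) (z : ℝ) : ℝ :=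
  (-1) ^ j * Real.exp (z ^ 2) * iteratedDeriv j (fun t : ℝ => Real.exp (-t ^ 2)) z

lemma integrable_abs_pow_mul_exp_neg_sq_mul {a : ℝ} (ha : 0 < a) (n : ℕ) :
    Integrable fun lam : ℝ => |lam| ^ n * Real.exp (-lam ^ 2 * a) := by
  have h := (integrable_rpow_mul_exp_neg_mul_sq ha (s := n)
    (by have : (0 : ℝ) ≤ n := n.cast_nonneg
        linarith)).norm
  refine h.congr (Filter.Eventually.of_forall fun lam => ?_)
  simp only [Real.rpow_natCast, norm_mul, norm_pow, Real.norm_eq_abs, Real.abs_exp]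
  congr 2
  ring

/-- The `j`-th derivative, taken under the integral sign, of the (unnormalised) inverse Fourier
transform of `e^{-λ²a}`. -/
noncomputable def gaussianFourierMoment (a : ℝ) (j : ℕ) (x : ℝ) : ℂ :=
  ∫ lam : ℝ, (Complex.I * (lam : ℂ)) ^ j * Complex.exp (-(lam : ℂ) ^ 2 * (a : ℂ)) *
    Complex.exp (Complex.I * (lam : ℂ) * (x : ℂ))

lemma norm_gaussianFourierMoment_integrand (a : ℝ) (j : ℕ) (x lam : ℝ) :
    ‖(Complex.I * (lam : ℂ)) ^ j * Complex.exp (-(lam : ℂ) ^ 2 * (a : ℂ)) *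
      Complex.exp (Complex.I * (lam : ℂ) * (x : ℂ))‖ = |lam| ^ j * Real.exp (-lam ^ 2 * a) := by
  have h₁ : Complex.I * (lam : ℂ) * (x : ℂ) = ((lam * x : ℝ) : ℂ) * Complex.I := by
    push_cast
    ring
  have h₂ : -(lam : ℂ) ^ 2 * (a : ℂ) = ((-lam ^ 2 * a : ℝ) : ℂ) := by push_cast; ring
  rw [h₁, h₂, norm_mul, norm_mul, Complex.norm_exp_ofReal_mul_I, ← Complex.ofReal_exp,
    Complex.norm_real, Real.norm_eq_abs, Real.abs_exp, norm_pow, norm_mul, Complex.norm_I,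
    Complex.norm_real, Real.norm_eq_abs, one_mul, mul_one]

lemma hasDerivAt_gaussianFourierMoment {a : ℝ} (ha : 0 < a) (j : ℕ) (x : ℝ) :
    HasDerivAt (gaussianFourierMoment a j) (gaussianFourierMoment a (j + 1) x) x := by
  refine (hasDerivAt_integral_of_dominated_loc_of_deriv_le
    (F := fun (y : ℝ) (lam : ℝ) => (Complex.I * (lam : ℂ)) ^ j *
      Complex.exp (-(lam : ℂ) ^ 2 * (a : ℂ)) * Complex.exp (Complex.I * (lam : ℂ) * (y : ℂ)))
    (F' := fun (y : ℝ) (lam : ℝ) => (Complex.I * (lam : ℂ)) ^ (j + 1) *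
      Complex.exp (-(lam : ℂ) ^ 2 * (a : ℂ)) * Complex.exp (Complex.I * (lam : ℂ) * (y : ℂ)))
    (bound := fun lam => |lam| ^ (j + 1) * Real.exp (-lam ^ 2 * a))
    Filter.univ_mem ?_ ?_ ?_ ?_ (integrable_abs_pow_mul_exp_neg_sq_mul ha (j + 1)) ?_).2
  · exact Filter.Eventually.of_forall fun y => by fun_prop
  · refine (integrable_abs_pow_mul_exp_neg_sq_mul ha j).mono' (by fun_prop) ?_
    exact Filter.Eventually.of_forall fun lam =>
      (norm_gaussianFourierMoment_integrand a j x lam).le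
  · fun_prop
  · exact Filter.Eventually.of_forall fun lam y _ =>
      (norm_gaussianFourierMoment_integrand a (j + 1) y lam).le
  · refine Filter.Eventually.of_forall fun lam y _ => ?_
    have h : HasDerivAt (fun y : ℝ => Complex.I * (lam : ℂ) * (y : ℂ)) (Complex.I * lam) y := by
      simpa using (Complex.ofRealCLM.hasDerivAt (x := y)).const_mul (Complex.I * (lam : ℂ))
    refine (h.cexp.const_mul _).congr_deriv ?_
    ring

lemma gaussianFourierMoment_zero {a : ℝ} (ha : 0 < a) (x : ℝ) :
    gaussianFourierMoment a 0 x =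
      ((Real.sqrt (Real.pi / a) * Real.exp (-(x / (2 * Real.sqrt a)) ^ 2) : ℝ) : ℂ) := by
  have h := fourierIntegral_gaussian (b := (a : ℂ)) (by simpa using ha) (x : ℂ)
  have hsqrt : ((Real.pi : ℂ) / (a : ℂ)) ^ (1 / 2 : ℂ) = ((Real.sqrt (Real.pi / a) : ℝ) : ℂ) := by
    rw [Real.sqrt_eq_rpow, Complex.ofReal_cpow (by positivity)]
    push_cast
    rfl
  have hexp : -(x / (2 * Real.sqrt a)) ^ 2 = -x ^ 2 / (4 * a) := by
    rw [div_pow, mul_pow, Real.sq_sqrt ha.le]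
    ring
  rw [hsqrt] at h
  rw [hexp]
  push_cast
  rw [← h, gaussianFourierMoment]
  congr 1 with lam
  rw [pow_zero, one_mul, mul_comm]
  congr 2 <;> ring

lemma gaussianFourierMoment_eq_iteratedDeriv {a : ℝ} (ha : 0 < a) (j : ℕ) (x : ℝ) :
    gaussianFourierMoment a j x =
      ((Real.sqrt (Real.pi / a) * ((1 / (2 * Real.sqrt a)) ^ j *
        iteratedDeriv j (fun t : ℝ => Real.exp (-t ^ 2)) (x / (2 * Real.sqrt a))) : ℝ) : ℂ) := by
  induction j generalizing x with
  | zero => simp only [gaussianFourierMoment_zero ha, pow_zero, one_mul, iteratedDeriv_zero]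
  | succ j ih =>
    have hsmooth : ContDiff ℝ (j + 1 : ℕ) fun t : ℝ => Real.exp (-t ^ 2) := by fun_prop
    have hg : HasDerivAt (iteratedDeriv j fun t : ℝ => Real.exp (-t ^ 2))
        (iteratedDeriv (j + 1) (fun t : ℝ => Real.exp (-t ^ 2)) (x / (2 * Real.sqrt a)))
        (x / (2 * Real.sqrt a)) := by
      rw [iteratedDeriv_succ]
      exact (hsmooth.differentiable_iteratedDeriv j (by exact_mod_cast j.lt_succ_self)
        _).hasDerivAt
    have h := (((hg.comp x ((hasDerivAt_id x).div_const (2 * Real.sqrt a))).const_mul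
      ((1 / (2 * Real.sqrt a)) ^ j)).const_mul (Real.sqrt (Real.pi / a))).ofReal_comp
    refine ((hasDerivAt_gaussianFourierMoment ha j x).unique
      (h.congr_of_eventuallyEq (Filter.Eventually.of_forall ih))).trans ?_
    congr 1
    ring

/-- For `a > 0`, real `x` and natural `j`,
`(1/(2π)) ∫_ℝ (−iλ)^j e^{−λ²a} e^{iλx} dλ
  = (e^{−x²/(4a)}/(2√(πa))) · (1/(2√a))^j · H_j(x/(2√a))`. -/
theorem fourier_gaussian_moment (a : ℝ) (ha : 0 < a) (x : ℝ) (j : ℕ) :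
    (1 / (2 * (Real.pi : ℂ))) *
        ∫ lam : ℝ,
          (-Complex.I * (lam : ℂ)) ^ j * Complex.exp (-(lam : ℂ) ^ 2 * (a : ℂ)) *
            Complex.exp (Complex.I * (lam : ℂ) * (x : ℂ)) =
      ((Real.exp (-x ^ 2 / (4 * a)) / (2 * Real.sqrt (Real.pi * a)) *
          (1 / (2 * Real.sqrt a)) ^ j * hermiteH j (x / (2 * Real.sqrt a)) : ℝ) : ℂ) := by
  have hint : (∫ lam : ℝ,
      (-Complex.I * (lam : ℂ)) ^ j * Complex.exp (-(lam : ℂ) ^ 2 * (a : ℂ)) *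
        Complex.exp (Complex.I * (lam : ℂ) * (x : ℂ))) =
      (-1) ^ j * gaussianFourierMoment a j x := by
    rw [gaussianFourierMoment, ← integral_const_mul]
    congr 1 with lam
    rw [neg_mul, neg_pow]
    ring
  have hexp : Real.exp (-x ^ 2 / (4 * a)) * Real.exp ((x / (2 * Real.sqrt a)) ^ 2) = 1 := by
    rw [← Real.exp_add, div_pow, mul_pow, Real.sq_sqrt ha.le, Real.exp_eq_one_iff]
    ring
  have hconst : 1 / (2 * Real.pi) * Real.sqrt (Real.pi / a) =
      1 / (2 * Real.sqrt (Real.pi * a)) := by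
    rw [Real.sqrt_div Real.pi_pos.le, Real.sqrt_mul Real.pi_pos.le]
    have := Real.sqrt_pos.2 ha
    have := Real.sqrt_pos.2 Real.pi_pos
    have := Real.pi_pos
    field_simp
    exact Real.sq_sqrt Real.pi_pos.le
  rw [hint, gaussianFourierMoment_eq_iteratedDeriv ha, hermiteH]
  set D := iteratedDeriv j (fun t : ℝ => Real.exp (-t ^ 2)) (x / (2 * Real.sqrt a))
  set s := (1 / (2 * Real.sqrt a)) ^ j
  have hreal : 1 / (2 * Real.pi) * ((-1) ^ j * (Real.sqrt (Real.pi / a) * (s * D))) =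
      Real.exp (-x ^ 2 / (4 * a)) / (2 * Real.sqrt (Real.pi * a)) * s *
        ((-1) ^ j * Real.exp ((x / (2 * Real.sqrt a)) ^ 2) * D) := by
    linear_combination (-1) ^ j * s * D * hconst -
      (-1) ^ j * s * D * (1 / (2 * Real.sqrt (Real.pi * a))) * hexp
  rw [← hreal]
  push_cast
  rfl
end

section
/- Let f : ℝ → ℝ be continuous with compact support, let τ > 0 and β > 0, and let u(τ,x) = (1/(2√(πτ))) ∫_ℝ exp(−(x−ξ)²/(4τ)) f(ξ) dξ be the solution of the Cauchy problem for the heat equation with initial datum f. Then for every real x the series ∑_{j=0}^∞ (1/(2√(τ+β))^j) · H_j(x/(2√(τ+β))) · (β^{j/2}/j!) · f_j converges, where f_j = ∫_ℝ H_j(ξ/(2√β)) f(ξ) dξ, and u(τ,x) = (e^{−x²/(4(τ+β))} / (2√(π(τ+β)))) · ∑_{j=0}^∞ (1/(2√(τ+β))^j) · H_j(x/(2√(τ+β))) · (β^{j/2}/j!) · f_j. -/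
open Real MeasureTheory

open FourierTransform

theorem contDiff_exp_neg_sq : ContDiff ℝ ⊤ (fun t : ℝ => Real.exp (-t ^ 2)) := by
  fun_prop

theorem continuous_hermiteH (j : ℕ) : Continuous (hermiteH j) := by
  have h : Continuous (iteratedDeriv j (fun t : ℝ => Real.exp (-t ^ 2))) :=
    contDiff_exp_neg_sq.continuous_iteratedDeriv j (by exact_mod_cast le_top)
  unfold hermiteH
  fun_prop

theorem iteratedDeriv_ofReal_comp {g : ℝ → ℝ} (hg : ContDiff ℝ ⊤ g) (j : ℕ) :
    iteratedDeriv j (fun t => (g t : ℂ)) = fun t => ((iteratedDeriv j g t : ℝ) : ℂ) := by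
  induction j with
  | zero => simp
  | succ n ih =>
    ext t
    rw [iteratedDeriv_succ, ih, iteratedDeriv_succ]
    exact ((hg.differentiable_iteratedDeriv n (by exact_mod_cast WithTop.coe_lt_top _)) t
      |>.hasDerivAt.ofReal_comp).deriv

theorem integrable_pow_mul_gaussian (j : ℕ) {r : ℝ} (hr : 0 < r) :
    Integrable (fun x : ℝ => x ^ j * Real.exp (-r * x ^ 2)) := by
  simpa using integrable_rpow_mul_exp_neg_mul_sq hr (s := j)
    (by have : (0 : ℝ) ≤ j := j.cast_nonneg
        linarith)

/-- The integrand of the Gaussian integral representation of `exp (-z²) * hermiteH j z`. -/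
noncomputable def hermiteKernel (j : ℕ) (z x : ℝ) : ℂ :=
  (√π : ℂ) * (2 * π * Complex.I * x) ^ j *
    Complex.exp (-(π : ℂ) ^ 2 * (x : ℂ) ^ 2 - 2 * π * Complex.I * z * x)

theorem continuous_hermiteKernel (j : ℕ) (z : ℝ) : Continuous (hermiteKernel j z) := by
  unfold hermiteKernel
  fun_prop

theorem norm_hermiteKernel (j : ℕ) (z x : ℝ) :
    ‖hermiteKernel j z x‖ = √π * (2 * π * |x|) ^ j * Real.exp (-π ^ 2 * x ^ 2) := by
  have h : (-(π : ℂ) ^ 2 * (x : ℂ) ^ 2 - 2 * π * Complex.I * z * x).re = -π ^ 2 * x ^ 2 := by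
    have : (-(π : ℂ) ^ 2 * (x : ℂ) ^ 2 - 2 * π * Complex.I * z * x)
        = ((-π ^ 2 * x ^ 2 : ℝ) : ℂ) + ((-2 * π * z * x : ℝ) : ℂ) * Complex.I := by
      push_cast; ring
    rw [this]
    simp only [Complex.add_re, Complex.ofReal_re, Complex.re_ofReal_mul, Complex.I_re, mul_zero,
      add_zero]
  rw [hermiteKernel, norm_mul, Complex.norm_exp, h, norm_mul, norm_pow]
  simp [abs_of_pos Real.pi_pos, abs_of_nonneg (Real.sqrt_nonneg π)]

theorem integrable_hermiteKernel (j : ℕ) (z : ℝ) : Integrable (hermiteKernel j z) := by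
  refine (((integrable_pow_mul_gaussian j (r := π ^ 2) (by positivity)).norm.const_mul
    (√π * (2 * π) ^ j)).mono' (continuous_hermiteKernel j z).aestronglyMeasurable
    (Filter.Eventually.of_forall fun x => ?_))
  rw [norm_hermiteKernel, norm_mul, norm_pow, Real.norm_eq_abs, Real.norm_eq_abs, Real.abs_exp,
    mul_pow]
  exact le_of_eq (by ring)

theorem fourier_gaussian_eq_exp_neg_sq :
    𝓕 (fun x : ℝ => (√π : ℂ) * Complex.exp (-π * (π : ℂ) * (x : ℂ) ^ 2)) =
      fun z : ℝ => ((Real.exp (-z ^ 2) : ℝ) : ℂ) := by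
  ext z
  have h := congrFun (fourier_gaussian_pi (b := (π : ℂ)) (by simpa using Real.pi_pos)) z
  rw [Real.fourier_real_eq_integral_exp_smul] at h ⊢
  have hs : (π : ℂ) ^ (1 / 2 : ℂ) = (√π : ℂ) := by
    rw [Real.sqrt_eq_rpow, Complex.ofReal_cpow Real.pi_pos.le]
    norm_num
  have hpi : (√π : ℂ) ≠ 0 := by
    exact_mod_cast (Real.sqrt_pos.2 Real.pi_pos).ne'
  have hpi' : (π : ℂ) ≠ 0 := by exact_mod_cast Real.pi_ne_zero
  rw [hs] at h
  simp only [smul_eq_mul, mul_left_comm _ (√π : ℂ)] at h ⊢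
  rw [integral_const_mul, h]
  push_cast
  field_simp

theorem ofReal_hermiteH (j : ℕ) (z : ℝ) :
    (hermiteH j z : ℂ) = Real.exp (z ^ 2) * ∫ x, hermiteKernel j z x := by
  have key := congrFun (iteratedDeriv_ofReal_comp contDiff_exp_neg_sq j) z
  rw [← fourier_gaussian_eq_exp_neg_sq, Real.iteratedDeriv_fourier (N := ⊤) ?_ le_top] at key
  · rw [hermiteH, Complex.ofReal_mul, Complex.ofReal_mul, ← key,
      Real.fourier_real_eq_integral_exp_smul, mul_comm ((((-1) ^ j : ℝ)) : ℂ), mul_assoc,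
      ← integral_const_mul]
    congr 2 with x
    have hexp : Complex.exp (-(π : ℂ) ^ 2 * (x : ℂ) ^ 2 - 2 * π * Complex.I * z * x) =
        Complex.exp (((-2 * π * x * z : ℝ) : ℂ) * Complex.I) *
          Complex.exp (-π * (π : ℂ) * (x : ℂ) ^ 2) := by
      rw [← Complex.exp_add]
      congr 1
      push_cast
      ring
    have hpow : (2 * π * Complex.I * x : ℂ) ^ j = (-1) ^ j * (-2 * π * Complex.I * x) ^ j := by
      rw [← mul_pow]
      ring
    rw [hermiteKernel, hexp, hpow]
    simp only [smul_eq_mul]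
    push_cast
    ring
  · intro n _
    refine (((integrable_pow_mul_gaussian n (r := π ^ 2) (by positivity)).ofReal (𝕜 := ℂ)).const_mul
      (√π : ℂ)).congr (Filter.Eventually.of_forall fun x => ?_)
    simp only [Complex.real_smul, Complex.coe_algebraMap, RCLike.ofReal_mul]
    simp
    ring_nf

theorem hasSum_hermiteKernel (w a b x y : ℝ) :
    HasSum (fun j : ℕ => hermiteKernel j a x * hermiteKernel j b y *
        ((w / 2) ^ j / (j.factorial : ℝ) : ℝ))
      (π * Complex.exp (-(π : ℂ) ^ 2 * (y : ℂ) ^ 2 +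
        (-2 * π * Complex.I * b - 2 * π ^ 2 * w * x) * y +
        (-(π : ℂ) ^ 2 * (x : ℂ) ^ 2 - 2 * π * Complex.I * a * x))) := by
  have h := (NormedSpace.expSeries_div_hasSum_exp (-2 * π ^ 2 * w * x * y : ℂ)).mul_left
    (π * Complex.exp (-(π : ℂ) ^ 2 * (x : ℂ) ^ 2 - 2 * π * Complex.I * a * x +
      (-(π : ℂ) ^ 2 * (y : ℂ) ^ 2 - 2 * π * Complex.I * b * y)))
  rw [← Complex.exp_eq_exp_ℂ, mul_assoc (π : ℂ), ← Complex.exp_add] at h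
  convert! h using 1
  · ext j
    have hpi : (√π : ℂ) * √π = π := by exact_mod_cast Real.mul_self_sqrt Real.pi_pos.le
    have hpow : (-2 * π ^ 2 * w * x * y : ℂ) ^ j =
        (2 * π * Complex.I * x) ^ j * (2 * π * Complex.I * y) ^ j * (w / 2) ^ j := by
      rw [← mul_pow, ← mul_pow]
      congr 1
      linear_combination (-2 * π ^ 2 * w * x * y : ℂ) * Complex.I_sq
    rw [hermiteKernel, hermiteKernel, hpow, Complex.exp_add, ← hpi]
    push_cast
    ring
  · congr 2
    ring

theorem norm_hermiteKernel_mul_eq {w : ℝ} (hw0 : 0 ≤ w) (j : ℕ) (a b x y : ℝ) :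
    ‖hermiteKernel j a x * hermiteKernel j b y * ((w / 2) ^ j / (j.factorial : ℝ) : ℝ)‖ =
      π * (Real.exp (-π ^ 2 * x ^ 2) * Real.exp (-π ^ 2 * y ^ 2)) *
        ((2 * π ^ 2 * w * |x| * |y|) ^ j / j.factorial) := by
  have hpow : (2 * π ^ 2 * w * |x| * |y|) ^ j =
      (2 * π * |x|) ^ j * (2 * π * |y|) ^ j * (w / 2) ^ j := by
    rw [← mul_pow, ← mul_pow]
    ring
  rw [norm_mul, norm_mul, norm_hermiteKernel, norm_hermiteKernel, Complex.norm_real,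
    Real.norm_of_nonneg (by positivity), hpow]
  linear_combination ((2 * π * |x|) ^ j * Real.exp (-π ^ 2 * x ^ 2) * (2 * π * |y|) ^ j *
    Real.exp (-π ^ 2 * y ^ 2) * ((w / 2) ^ j / j.factorial)) * Real.mul_self_sqrt Real.pi_pos.le

theorem sum_norm_hermiteKernel_mul_le {w : ℝ} (hw0 : 0 ≤ w) (a b x y : ℝ) (s : Finset ℕ) :
    ∑ j ∈ s, ‖hermiteKernel j a x * hermiteKernel j b y *
        ((w / 2) ^ j / (j.factorial : ℝ) : ℝ)‖ ≤
      π * (Real.exp (-(π ^ 2 * (1 - w)) * x ^ 2) * Real.exp (-(π ^ 2 * (1 - w)) * y ^ 2)) := by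
  simp_rw [norm_hermiteKernel_mul_eq hw0]
  rw [← Finset.mul_sum]
  have h := sum_le_hasSum s (fun j _ => by positivity)
    (NormedSpace.expSeries_div_hasSum_exp (2 * π ^ 2 * w * |x| * |y|))
  rw [← Real.exp_eq_exp_ℝ] at h
  refine (mul_le_mul_of_nonneg_left h (by positivity)).trans ?_
  rw [mul_assoc, ← Real.exp_add, ← Real.exp_add, ← Real.exp_add]
  refine mul_le_mul_of_nonneg_left (Real.exp_le_exp.2 ?_) Real.pi_pos.le
  have : 0 ≤ π ^ 2 * w * (|x| - |y|) ^ 2 := by positivity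
  rw [sub_sq, sq_abs, sq_abs] at this
  linarith

theorem integrable_gaussian_prod {r : ℝ} (hr : 0 < r) (c : ℝ) :
    Integrable (fun p : ℝ × ℝ => c * (Real.exp (-r * p.1 ^ 2) * Real.exp (-r * p.2 ^ 2))) :=
  ((integrable_exp_neg_mul_sq hr).mul_prod (integrable_exp_neg_mul_sq hr)).const_mul c

theorem integrable_hermiteKernel_mul (w : ℝ) (j : ℕ) (a b : ℝ) :
    Integrable (fun p : ℝ × ℝ => hermiteKernel j a p.1 * hermiteKernel j b p.2 *
        ((w / 2) ^ j / (j.factorial : ℝ) : ℝ)) :=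
  ((integrable_hermiteKernel j a).mul_prod (integrable_hermiteKernel j b)).mul_const _

theorem cpow_half_gaussian {r : ℝ} (hr : 0 < r) :
    ((π : ℂ) / -(-(r : ℂ))) ^ (1 / 2 : ℂ) = (√(π / r) : ℝ) := by
  rw [Real.sqrt_eq_rpow, Complex.ofReal_cpow (by positivity)]
  push_cast
  rw [neg_neg]

theorem integral_cexp_neg_quadratic {r : ℝ} (hr : 0 < r) (c d : ℂ) :
    ∫ x : ℝ, Complex.exp (-(r : ℂ) * x ^ 2 + c * x + d) =
      (√(π / r) : ℝ) * Complex.exp (d + c ^ 2 / (4 * r)) := by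
  rw [integral_cexp_quadratic (by simpa using hr), cpow_half_gaussian hr]
  congr 2
  rw [mul_neg, div_neg, sub_neg_eq_add]

theorem integral_integral_mehler {w : ℝ} (hw0 : 0 ≤ w) (hw1 : w < 1) (a b : ℝ) :
    (∫ x : ℝ, ∫ y : ℝ, π * Complex.exp (-(π : ℂ) ^ 2 * (y : ℂ) ^ 2 +
        (-2 * π * Complex.I * b - 2 * π ^ 2 * w * x) * y +
        (-(π : ℂ) ^ 2 * (x : ℂ) ^ 2 - 2 * π * Complex.I * a * x))) =
      ((1 / √(1 - w ^ 2) * Real.exp (-b ^ 2 - (a - b * w) ^ 2 / (1 - w ^ 2)) : ℝ) : ℂ) := by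
  have hw : 0 < 1 - w ^ 2 := by nlinarith
  have hpi : (π : ℂ) ≠ 0 := by exact_mod_cast Real.pi_ne_zero
  have hwC : (1 - w ^ 2 : ℂ) ≠ 0 := by exact_mod_cast hw.ne'
  have inner (x : ℝ) : (∫ y : ℝ, π * Complex.exp (-(π : ℂ) ^ 2 * (y : ℂ) ^ 2 +
        (-2 * π * Complex.I * b - 2 * π ^ 2 * w * x) * y +
        (-(π : ℂ) ^ 2 * (x : ℂ) ^ 2 - 2 * π * Complex.I * a * x))) =
      π * (√(π / π ^ 2) : ℝ) * Complex.exp (-((π ^ 2 * (1 - w ^ 2) : ℝ) : ℂ) * (x : ℂ) ^ 2 +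
        (2 * π * Complex.I * (b * w - a)) * x + (-b ^ 2 : ℂ)) := by
    have h := integral_cexp_neg_quadratic (r := π ^ 2) (by positivity)
      (-2 * π * Complex.I * b - 2 * π ^ 2 * w * x)
      (-(π : ℂ) ^ 2 * (x : ℂ) ^ 2 - 2 * π * Complex.I * a * x)
    rw [Complex.ofReal_pow] at h
    rw [integral_const_mul, h]
    refine (mul_assoc _ _ _).symm.trans ?_
    congr 2
    push_cast
    field_simp
    linear_combination (4 * b ^ 2 : ℂ) * Complex.I_sq
  simp_rw [inner]
  rw [integral_const_mul, integral_cexp_neg_quadratic (by positivity)]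
  have hconst : π * √(π / π ^ 2) * √(π / (π ^ 2 * (1 - w ^ 2))) = 1 / √(1 - w ^ 2) := by
    have h1 : π / π ^ 2 = π⁻¹ := by field_simp
    have h2 : π / (π ^ 2 * (1 - w ^ 2)) = π⁻¹ * (1 - w ^ 2)⁻¹ := by field_simp
    rw [h1, h2, Real.sqrt_mul (by positivity), ← mul_assoc, mul_assoc π,
      Real.mul_self_sqrt (by positivity), mul_inv_cancel₀ Real.pi_ne_zero, one_mul,
      Real.sqrt_inv, one_div]
  rw [← mul_assoc, Complex.ofReal_mul (1 / _), ← hconst, Complex.ofReal_exp]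
  push_cast
  congr 2
  field_simp
  linear_combination (4 * (b * w - a) ^ 2 : ℂ) * Complex.I_sq

/-- A bound for the Mehler terms, uniform in the arguments up to a Gaussian factor. -/
noncomputable def mehlerBound (w : ℝ) (j : ℕ) : ℝ :=
  ∫ p : ℝ × ℝ, ‖hermiteKernel j 0 p.1 * hermiteKernel j 0 p.2 *
    ((w / 2) ^ j / (j.factorial : ℝ) : ℝ)‖

theorem summable_mehlerBound {w : ℝ} (hw0 : 0 ≤ w) (hw1 : w < 1) :
    Summable (mehlerBound w) := by
  refine summable_of_sum_le (c := ∫ p : ℝ × ℝ, π * (Real.exp (-(π ^ 2 * (1 - w)) * p.1 ^ 2) *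
    Real.exp (-(π ^ 2 * (1 - w)) * p.2 ^ 2))) (fun j => integral_nonneg fun p => norm_nonneg _) fun s => ?_
  unfold mehlerBound
  rw [← integral_finsetSum s fun j _ => (integrable_hermiteKernel_mul w j 0 0).norm]
  exact integral_mono
    (integrable_finsetSum s fun j _ => (integrable_hermiteKernel_mul w j 0 0).norm)
    (integrable_gaussian_prod (r := π ^ 2 * (1 - w))
      (mul_pos (by positivity) (sub_pos.2 hw1)) π)
    fun p => sum_norm_hermiteKernel_mul_le hw0 0 0 p.1 p.2 s

theorem integral_norm_hermiteKernel_mul (w : ℝ) (j : ℕ) (a b : ℝ) :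
    ∫ p : ℝ × ℝ, ‖hermiteKernel j a p.1 * hermiteKernel j b p.2 *
      ((w / 2) ^ j / (j.factorial : ℝ) : ℝ)‖ = mehlerBound w j := by
  simp only [mehlerBound, norm_mul, norm_hermiteKernel]

theorem ofReal_mehler_term (w : ℝ) (j : ℕ) (a b : ℝ) :
    ((hermiteH j a * hermiteH j b * ((w / 2) ^ j / (j.factorial : ℝ)) : ℝ) : ℂ) =
      Real.exp (a ^ 2) * Real.exp (b ^ 2) *
        ∫ p : ℝ × ℝ, hermiteKernel j a p.1 * hermiteKernel j b p.2 *
          ((w / 2) ^ j / (j.factorial : ℝ) : ℝ) := by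
  rw [integral_mul_const, Measure.volume_eq_prod, integral_prod_mul, Complex.ofReal_mul,
    Complex.ofReal_mul, ofReal_hermiteH, ofReal_hermiteH]
  ring

theorem norm_mehler_term_le (w : ℝ) (j : ℕ) (a b : ℝ) :
    ‖hermiteH j a * hermiteH j b * ((w / 2) ^ j / (j.factorial : ℝ))‖ ≤
      Real.exp (a ^ 2) * Real.exp (b ^ 2) * mehlerBound w j := by
  rw [← Complex.norm_real, ofReal_mehler_term, norm_mul, norm_mul, Complex.norm_real,
    Complex.norm_real, Real.norm_of_nonneg (Real.exp_pos _).le,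
    Real.norm_of_nonneg (Real.exp_pos _).le, ← integral_norm_hermiteKernel_mul w j a b]
  gcongr
  exact norm_integral_le_integral_norm _

/-- **Mehler's formula** for the physicists' Hermite polynomials. -/
theorem hasSum_mehler {w : ℝ} (hw0 : 0 ≤ w) (hw1 : w < 1) (a b : ℝ) :
    HasSum (fun j : ℕ => hermiteH j a * hermiteH j b * ((w / 2) ^ j / (j.factorial : ℝ)))
      (1 / √(1 - w ^ 2) * Real.exp (a ^ 2 - (a - b * w) ^ 2 / (1 - w ^ 2))) := by
  have hsum := hasSum_integral_of_summable_integral_norm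
    (fun j => integrable_hermiteKernel_mul w j a b)
    (by simpa only [integral_norm_hermiteKernel_mul] using summable_mehlerBound hw0 hw1)
  simp only [(hasSum_hermiteKernel w a b _ _).tsum_eq] at hsum
  have hint : Integrable (fun p : ℝ × ℝ => π * Complex.exp (-(π : ℂ) ^ 2 * (p.2 : ℂ) ^ 2 +
        (-2 * π * Complex.I * b - 2 * π ^ 2 * w * p.1) * p.2 +
        (-(π : ℂ) ^ 2 * (p.1 : ℂ) ^ 2 - 2 * π * Complex.I * a * p.1))) := by
    refine (integrable_gaussian_prod (r := π ^ 2 * (1 - w))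
      (mul_pos (by positivity) (sub_pos.2 hw1)) π).mono'
      (by fun_prop : Continuous _).aestronglyMeasurable (Filter.Eventually.of_forall fun p => ?_)
    exact le_of_tendsto (hasSum_hermiteKernel w a b p.1 p.2).norm
      (Filter.Eventually.of_forall fun s =>
        (norm_sum_le _ _).trans (sum_norm_hermiteKernel_mul_le hw0 a b p.1 p.2 s))
  rw [Measure.volume_eq_prod, integral_prod _ hint, integral_integral_mehler hw0 hw1] at hsum
  have h := hsum.mul_left ((Real.exp (a ^ 2) : ℂ) * Real.exp (b ^ 2))
  simp only [← Measure.volume_eq_prod, ← ofReal_mehler_term] at h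
  rw [← Complex.hasSum_ofReal]
  convert! h using 1
  rw [← Complex.ofReal_mul, ← Complex.ofReal_mul]
  congr 1
  rw [mul_left_comm, ← Real.exp_add, ← Real.exp_add]
  congr 2
  ring

/-- Mehler's formula integrated against a continuous compactly supported function. -/
theorem hasSum_integral_mehler {f : ℝ → ℝ} (hf : Continuous f) (hsupp : HasCompactSupport f)
    {w : ℝ} (hw0 : 0 ≤ w) (hw1 : w < 1) (a c : ℝ) :
    HasSum (fun j : ℕ => hermiteH j a * ((w / 2) ^ j / (j.factorial : ℝ)) *
        ∫ ξ, hermiteH j (ξ / c) * f ξ)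
      (∫ ξ, 1 / √(1 - w ^ 2) *
        Real.exp (a ^ 2 - (a - ξ / c * w) ^ 2 / (1 - w ^ 2)) * f ξ) := by
  have hintF (j : ℕ) : Integrable fun ξ =>
      hermiteH j a * hermiteH j (ξ / c) * ((w / 2) ^ j / (j.factorial : ℝ)) * f ξ := by
    have := continuous_hermiteH j
    exact Continuous.integrable_of_hasCompactSupport (by fun_prop) hsupp.mul_left
  have hintB : Integrable fun ξ => Real.exp (a ^ 2) * Real.exp ((ξ / c) ^ 2) * ‖f ξ‖ :=
    Continuous.integrable_of_hasCompactSupport (by fun_prop) hsupp.norm.mul_left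
  have hsum := hasSum_integral_of_summable_integral_norm hintF ?_
  · simp only [((hasSum_mehler hw0 hw1 a _).mul_right _).tsum_eq] at hsum
    convert! hsum using 1
    ext j
    rw [← integral_const_mul]
    congr 1 with ξ
    ring
  · refine Summable.of_nonneg_of_le (fun j => integral_nonneg fun ξ => norm_nonneg _)
      (fun j => ?_) ((summable_mehlerBound hw0 hw1).mul_left
        (∫ ξ, Real.exp (a ^ 2) * Real.exp ((ξ / c) ^ 2) * ‖f ξ‖))
    rw [← integral_mul_const]
    refine integral_mono (hintF j).norm (hintB.mul_const _) fun ξ => ?_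
    simp only [norm_mul _ (f ξ)]
    rw [mul_right_comm _ ‖f ξ‖]
    gcongr
    exact norm_mehler_term_le w j a (ξ / c)

/-- Hermite-series form of the solution of the direct Cauchy problem for the heat
equation: if `u(τ,x)` is the Poisson (heat kernel) integral of a continuous,
compactly supported initial datum `f`, then for every `x` the series
`∑_j (1/(2√(τ+β)))^j H_j(x/(2√(τ+β))) (β^{j/2}/j!) f_j` converges, with
`f_j = ∫ H_j(ξ/(2√β)) f(ξ) dξ`, and
`u(τ,x) = (e^{−x²/(4(τ+β))}/(2√(π(τ+β)))) ∑_j …`. -/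
theorem heat_solution_hermite_series (f : ℝ → ℝ) (hf : Continuous f)
    (hsupp : HasCompactSupport f) (τ β : ℝ) (hτ : 0 < τ) (hβ : 0 < β)
    (u : ℝ → ℝ)
    (hu : ∀ x : ℝ, u x =
      (1 / (2 * Real.sqrt (Real.pi * τ))) * ∫ ξ : ℝ, Real.exp (-(x - ξ) ^ 2 / (4 * τ)) * f ξ)
    (x : ℝ) :
    ∃ s : ℝ,
      HasSum
        (fun j : ℕ =>
          (1 / (2 * Real.sqrt (τ + β))) ^ j * hermiteH j (x / (2 * Real.sqrt (τ + β))) *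
            (β ^ ((j : ℝ) / 2) / (j.factorial : ℝ)) *
            ∫ ξ : ℝ, hermiteH j (ξ / (2 * Real.sqrt β)) * f ξ)
        s ∧
      u x = Real.exp (-x ^ 2 / (4 * (τ + β))) / (2 * Real.sqrt (Real.pi * (τ + β))) * s := by
  have hτβ : 0 < τ + β := by positivity
  set r := √(τ + β) with hr
  have hr0 : 0 < r := Real.sqrt_pos.2 hτβ
  have hr2 : r ^ 2 = τ + β := Real.sq_sqrt hτβ.le
  have hb0 : 0 < √β := Real.sqrt_pos.2 hβ
  have hb2 : √β ^ 2 = β := Real.sq_sqrt hβ.le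
  have ht0 : 0 < √τ := Real.sqrt_pos.2 hτ
  have hw : 1 - (√β / r) ^ 2 = τ / (τ + β) := by
    rw [div_pow, hb2, hr2]
    field_simp
    ring
  have hw0 : 0 ≤ √β / r := by positivity
  have hw1 : √β / r < 1 := (div_lt_one hr0).2 (Real.sqrt_lt_sqrt hβ.le (by linarith))
  have hsum := hasSum_integral_mehler hf hsupp hw0 hw1 (x / (2 * r)) (2 * √β)
  refine ⟨∫ ξ, 1 / √(1 - (√β / r) ^ 2) * Real.exp ((x / (2 * r)) ^ 2 -
    (x / (2 * r) - ξ / (2 * √β) * (√β / r)) ^ 2 / (1 - (√β / r) ^ 2)) * f ξ, ?_, ?_⟩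
  · convert! hsum using 1
    ext j
    have hpow : β ^ ((j : ℝ) / 2) = √β ^ j := by
      rw [Real.sqrt_eq_rpow, ← Real.rpow_natCast, ← Real.rpow_mul hβ.le]
      congr 1
      ring
    have hratio : (√β / r / 2) ^ j = √β ^ j * (1 / (2 * r)) ^ j := by
      rw [← mul_pow]
      ring
    rw [hpow, hratio]
    ring
  · rw [hu, ← integral_const_mul, ← integral_const_mul]
    congr 1 with ξ
    rw [hw, Real.sqrt_mul Real.pi_pos.le, Real.sqrt_mul Real.pi_pos.le, Real.sqrt_div hτ.le,
      ← hr]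
    have hexp : Real.exp (-(x - ξ) ^ 2 / (4 * τ)) = Real.exp (-x ^ 2 / (4 * (τ + β))) *
        Real.exp ((x / (2 * r)) ^ 2 -
          (x / (2 * r) - ξ / (2 * √β) * (√β / r)) ^ 2 / (τ / (τ + β))) := by
      rw [← Real.exp_add, ← hr2]
      congr 1
      field_simp
      ring
    rw [hexp]
    field_simp
end

section
/- Let f : ℝ → ℝ be infinitely differentiable with compact support, let τ > 0 and β > 0, and let u(τ,ξ) = (1/(2√(πτ))) ∫_ℝ exp(−(ξ−η)²/(4τ)) f(η) dη. Then for every real x the series ∑_{j=0}^∞ (1/(2√β)^j) · H_j(x/(2√(τ+β))) · ((τ+β)^{j/2}/j!) · u_j converges, where u_j = ∫_ℝ (e^{−ξ²/(4β)} / (2√(πβ))) · H_j(ξ/(2√β)) · u(τ,ξ) dξ, and its sum equals f(x). -/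
open Real MeasureTheory

open ProbabilityTheory Filter Topology

/-- The standard Gaussian measure on `ℝ`. -/
noncomputable abbrev stdNormal : Measure ℝ := gaussianReal 0 1

/-- The probabilists' Hermite polynomial as a real function. -/
noncomputable def hermiteHe (n : ℕ) (x : ℝ) : ℝ := Polynomial.aeval x (Polynomial.hermite n)

theorem Polynomial.derivative_hermite_succ (n : ℕ) :
    derivative (hermite (n + 1)) = (n + 1 : Polynomial ℤ) * hermite n := by
  induction n with
  | zero => simp [hermite_succ]
  | succ n ih =>
    rw [hermite_succ (n + 1), derivative_sub, derivative_mul, derivative_X, ih, derivative_mul,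
      hermite_succ n]
    have : derivative (n + 1 : Polynomial ℤ) = 0 := by simp
    rw [this]
    push_cast
    ring

theorem hermiteHe_zero (x : ℝ) : hermiteHe 0 x = 1 := by simp [hermiteHe]

theorem hermiteHe_one (x : ℝ) : hermiteHe 1 x = x := by simp [hermiteHe]

theorem hermiteHe_add_two (n : ℕ) (x : ℝ) :
    hermiteHe (n + 2) x = x * hermiteHe (n + 1) x - (n + 1) * hermiteHe n x := by
  rw [hermiteHe, Polynomial.hermite_succ, Polynomial.derivative_hermite_succ]
  simp [hermiteHe]

theorem hasDerivAt_hermiteHe (n : ℕ) (x : ℝ) :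
    HasDerivAt (hermiteHe n) (x * hermiteHe n x - hermiteHe (n + 1) x) x := by
  have h := Polynomial.hasDerivAt_aeval (Polynomial.hermite n) x
  have e : x * hermiteHe n x - hermiteHe (n + 1) x =
      Polynomial.aeval x (Polynomial.derivative (Polynomial.hermite n)) := by
    simp [hermiteHe, Polynomial.hermite_succ]
  rw [e]
  exact h

theorem hasDerivAt_hermiteHe_succ (n : ℕ) (x : ℝ) :
    HasDerivAt (hermiteHe (n + 1)) ((n + 1) * hermiteHe n x) x := by
  convert! hasDerivAt_hermiteHe (n + 1) x using 1
  rw [hermiteHe_add_two]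
  ring

theorem continuous_hermiteHe (n : ℕ) : Continuous (hermiteHe n) :=
  continuous_iff_continuousAt.2 fun x => (hasDerivAt_hermiteHe n x).continuousAt

theorem memLp_pow_stdNormal (n : ℕ) : MemLp (fun x : ℝ => x ^ n) 2 stdNormal := by
  rw [memLp_two_iff_integrable_sq (by fun_prop)]
  have h := (memLp_id_gaussianReal' (μ := 0) (v := 1) ((2 * n : ℕ) : ENNReal)
    (ENNReal.natCast_ne_top _)).integrable_norm_pow'
  refine h.congr (ae_of_all _ fun x => ?_)
  simp [pow_mul, mul_comm 2 n]
  rw [← pow_mul, ← pow_mul, mul_comm n 2, pow_mul, pow_mul, sq_abs]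

theorem memLp_hermiteHe (n : ℕ) : MemLp (hermiteHe n) 2 stdNormal := by
  have h : hermiteHe n = fun x => ∑ i ∈ Finset.range ((Polynomial.hermite n).natDegree + 1),
      ((Polynomial.hermite n).coeff i : ℝ) * x ^ i := by
    ext x
    simp [hermiteHe, Polynomial.aeval_eq_sum_range]
  rw [h]
  exact memLp_finsetSum _ fun i _ => (memLp_pow_stdNormal i).const_mul _

theorem integrable_hermiteHe_mul_hermiteHe (m n : ℕ) :
    Integrable (fun x => hermiteHe m x * hermiteHe n x) stdNormal :=
  (memLp_hermiteHe m).integrable_mul (memLp_hermiteHe n)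

theorem memLp_of_bounded {g : ℝ → ℝ} (hg : Continuous g) {M : ℝ} (hM : ∀ x, |g x| ≤ M)
    (μ : Measure ℝ) [IsFiniteMeasure μ] : MemLp g 2 μ :=
  MemLp.of_bound hg.aestronglyMeasurable M (ae_of_all _ hM)

theorem integrable_stdNormal_iff {g : ℝ → ℝ} :
    Integrable g stdNormal ↔ Integrable (fun x => gaussianPDFReal 0 1 x * g x) := by
  rw [stdNormal, gaussianReal_of_var_ne_zero _ one_ne_zero,
    integrable_withDensity_iff_integrable_smul' (measurable_gaussianPDF _ _)
      (ae_of_all _ fun _ => gaussianPDF_lt_top)]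
  simp

theorem hasDerivAt_gaussianPDFReal (x : ℝ) :
    HasDerivAt (gaussianPDFReal 0 1) (-x * gaussianPDFReal 0 1 x) x := by
  rw [gaussianPDFReal_def]
  have h : HasDerivAt (fun y : ℝ => -(y - 0) ^ 2 / (2 * ((1 : NNReal) : ℝ))) (-x) x := by
    convert! (((hasDerivAt_id x).sub_const 0).pow 2).neg.div_const (2 * ((1 : NNReal) : ℝ)) using 1
    simp
    ring
  convert! (h.exp.const_mul _) using 1
  ring

theorem hasDerivAt_gaussianPDFReal_mul_hermiteHe (n : ℕ) (x : ℝ) :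
    HasDerivAt (fun x => gaussianPDFReal 0 1 x * hermiteHe n x)
      (-(gaussianPDFReal 0 1 x * hermiteHe (n + 1) x)) x := by
  convert! (hasDerivAt_gaussianPDFReal x).mul (hasDerivAt_hermiteHe n x) using 1
  ring

/-- Gaussian integration by parts (Stein's identity). -/
theorem integral_hermiteHe_succ_mul (n : ℕ) {g g' : ℝ → ℝ} (hg : ∀ x, HasDerivAt g (g' x) x)
    (h : MemLp g 2 stdNormal) (h' : MemLp g' 2 stdNormal) :
    ∫ x, hermiteHe (n + 1) x * g x ∂stdNormal = ∫ x, hermiteHe n x * g' x ∂stdNormal := by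
  have key := integral_mul_deriv_eq_deriv_mul_of_integrable
    (fun x _ => hasDerivAt_gaussianPDFReal_mul_hermiteHe n x) (fun x _ => hg x)
    (by
      have := integrable_stdNormal_iff.1 ((memLp_hermiteHe n).integrable_mul h')
      exact this.congr (ae_of_all _ fun x => by simp [mul_assoc]))
    (by
      have := integrable_stdNormal_iff.1 ((memLp_hermiteHe (n + 1)).integrable_mul h)
      exact this.neg.congr (ae_of_all _ fun x => by simp [mul_assoc]))
    (by
      have := integrable_stdNormal_iff.1 ((memLp_hermiteHe n).integrable_mul h)
      exact this.congr (ae_of_all _ fun x => by simp [mul_assoc]))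
  rw [integral_gaussianReal_eq_integral_smul one_ne_zero,
    integral_gaussianReal_eq_integral_smul one_ne_zero]
  simp only [smul_eq_mul, neg_mul, integral_neg, neg_neg, mul_assoc] at key ⊢
  exact key.symm

theorem integral_hermiteHe_sq (n : ℕ) :
    ∫ x, hermiteHe n x ^ 2 ∂stdNormal = (n.factorial : ℝ) := by
  induction n with
  | zero => simp [hermiteHe_zero]
  | succ n ih =>
    simp only [sq] at ih ⊢
    rw [integral_hermiteHe_succ_mul n (fun x => hasDerivAt_hermiteHe_succ n x) (memLp_hermiteHe _)
      ((memLp_hermiteHe n).const_mul _)]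
    simp only [mul_left_comm (hermiteHe n _) ((n : ℝ) + 1), integral_const_mul, ih]
    push_cast [Nat.factorial_succ]
    ring

theorem integral_hermiteHe_succ (n : ℕ) : ∫ x, hermiteHe (n + 1) x ∂stdNormal = 0 := by
  simpa using integral_hermiteHe_succ_mul n (fun x => hasDerivAt_const x (1 : ℝ))
    (memLp_const _) (memLp_const _)

theorem integrable_hermiteHe_sq (n : ℕ) : Integrable (fun x => hermiteHe n x ^ 2) stdNormal :=
  (memLp_hermiteHe n).integrable_sq

/-- Pointwise growth of the Hermite polynomials in the degree. -/
theorem gaussianPDFReal_mul_hermiteHe_sq_le (n : ℕ) (x : ℝ) :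
    gaussianPDFReal 0 1 x * hermiteHe n x ^ 2 ≤ (n + 2) * (n.factorial : ℝ) := by
  set G : ℝ → ℝ := fun y => (y * hermiteHe n y - hermiteHe (n + 1) y) * hermiteHe n y
    - hermiteHe n y * hermiteHe (n + 1) y with hG
  have hder : ∀ y, HasDerivAt (fun y => gaussianPDFReal 0 1 y * hermiteHe n y ^ 2)
      (gaussianPDFReal 0 1 y * G y) y := by
    intro y
    convert! (hasDerivAt_gaussianPDFReal_mul_hermiteHe n y).mul (hasDerivAt_hermiteHe n y) using 1
    · ext; simp; ring
    · simp [hG]; ring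
  have hGle : Integrable G stdNormal ∧ ∫ y, |G y| ∂stdNormal ≤ (n + 2) * (n.factorial : ℝ) := by
    cases n with
    | zero =>
      have e : G = fun y => - (hermiteHe 0 y * hermiteHe 1 y) := by
        ext y; simp [hG, hermiteHe_zero, hermiteHe_one]
      rw [e]
      refine ⟨(integrable_hermiteHe_mul_hermiteHe 0 1).neg, ?_⟩
      have hi : Integrable (fun y => hermiteHe 0 y ^ 2 + hermiteHe 1 y ^ 2) stdNormal :=
        (integrable_hermiteHe_sq 0).add (integrable_hermiteHe_sq 1)
      refine (integral_mono (integrable_hermiteHe_mul_hermiteHe 0 1).neg.abs hi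
        fun y => ?_).trans ?_
      · simp only [Pi.neg_apply, abs_neg]
        rw [abs_le]
        constructor <;> nlinarith [sq_nonneg (hermiteHe 0 y + hermiteHe 1 y),
          sq_nonneg (hermiteHe 0 y - hermiteHe 1 y)]
      · rw [integral_add (integrable_hermiteHe_sq 0) (integrable_hermiteHe_sq 1),
          integral_hermiteHe_sq, integral_hermiteHe_sq]
        norm_num
    | succ m =>
      have e : G = fun y => (m + 1) * (hermiteHe m y * hermiteHe (m + 1) y)
          - hermiteHe (m + 1) y * hermiteHe (m + 2) y := by
        ext y; simp [hG, hermiteHe_add_two]; ring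
      rw [e]
      have h1 : Integrable (fun y => (m + 1) * (hermiteHe m y * hermiteHe (m + 1) y)
          - hermiteHe (m + 1) y * hermiteHe (m + 2) y) stdNormal :=
        ((integrable_hermiteHe_mul_hermiteHe m (m + 1)).const_mul _).sub
          (integrable_hermiteHe_mul_hermiteHe (m + 1) (m + 2))
      refine ⟨h1, ?_⟩
      have a1 := (integrable_hermiteHe_sq m).const_mul (((m : ℝ) + 1) ^ 2 / 2)
      have a2 := integrable_hermiteHe_sq (m + 1)
      have a3 := (integrable_hermiteHe_sq (m + 2)).const_mul (1 / 2)
      refine (integral_mono h1.abs ((a1.add a2).add a3) fun y => ?_).trans ?_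
      · simp only [Pi.add_apply]
        rw [abs_le]
        constructor <;> nlinarith [sq_nonneg ((m + 1) * hermiteHe m y + hermiteHe (m + 1) y),
          sq_nonneg ((m + 1) * hermiteHe m y - hermiteHe (m + 1) y),
          sq_nonneg (hermiteHe (m + 2) y - hermiteHe (m + 1) y),
          sq_nonneg (hermiteHe (m + 2) y + hermiteHe (m + 1) y)]
      · rw [integral_add' (a1.add a2) a3, integral_add' a1 a2, integral_const_mul,
          integral_const_mul, integral_hermiteHe_sq, integral_hermiteHe_sq, integral_hermiteHe_sq]
        push_cast [Nat.factorial_succ]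
        have : (0 : ℝ) ≤ m.factorial := by positivity
        have : (0 : ℝ) ≤ m * m.factorial := by positivity
        nlinarith
  obtain ⟨hGi, hGb⟩ := hGle
  have hGi' := integrable_stdNormal_iff.1 hGi
  have hsq := integrable_stdNormal_iff.1 (integrable_hermiteHe_sq n)
  have hlim := tendsto_zero_of_hasDerivAt_of_integrableOn_Ioi (a := x) (fun y _ => hder y)
    hGi'.integrableOn hsq.integrableOn
  have hint := integral_Ioi_of_hasDerivAt_of_tendsto' (a := x) (fun y _ => hder y)
    hGi'.integrableOn hlim
  have e : gaussianPDFReal 0 1 x * hermiteHe n x ^ 2 =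
      -∫ y in Set.Ioi x, gaussianPDFReal 0 1 y * G y := by rw [hint]; ring
  rw [e]
  calc _ ≤ |∫ y in Set.Ioi x, gaussianPDFReal 0 1 y * G y| := neg_le_abs _
    _ ≤ ∫ y in Set.Ioi x, |gaussianPDFReal 0 1 y * G y| := abs_integral_le_integral_abs
    _ ≤ ∫ y, |gaussianPDFReal 0 1 y * G y| :=
        setIntegral_le_integral hGi'.abs (ae_of_all _ fun _ => abs_nonneg _)
    _ = ∫ y, |G y| ∂stdNormal := by
        rw [integral_gaussianReal_eq_integral_smul one_ne_zero]
        simp only [abs_mul, abs_of_nonneg (gaussianPDFReal_nonneg _ _ _), smul_eq_mul]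
    _ ≤ _ := hGb

/-- The successive derivatives of a smooth function, all of which are bounded. -/
structure IsBoundedDerivSeq (g : ℕ → ℝ → ℝ) : Prop where
  hasDerivAt : ∀ k x, HasDerivAt (g k) (g (k + 1) x) x
  bounded : ∀ k, ∃ M, ∀ x, |g k x| ≤ M

namespace IsBoundedDerivSeq

variable {g : ℕ → ℝ → ℝ}

theorem continuous (hg : IsBoundedDerivSeq g) (k : ℕ) : Continuous (g k) :=
  continuous_iff_continuousAt.2 fun x => (hg.hasDerivAt k x).continuousAt

theorem memLp (hg : IsBoundedDerivSeq g) (k : ℕ) (μ : Measure ℝ) [IsFiniteMeasure μ] :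
    MemLp (g k) 2 μ :=
  let ⟨_, hM⟩ := hg.bounded k
  memLp_of_bounded (hg.continuous k) hM μ

theorem integral_hermiteHe_add_mul (hg : IsBoundedDerivSeq g) (n i k : ℕ) :
    ∫ x, hermiteHe (n + k) x * g i x ∂stdNormal = ∫ x, hermiteHe n x * g (i + k) x ∂stdNormal := by
  induction k generalizing i with
  | zero => rfl
  | succ k ih =>
    rw [← add_assoc, integral_hermiteHe_succ_mul _ (hg.hasDerivAt i) (hg.memLp _ _)
      (hg.memLp _ _), ih, add_right_comm, add_assoc]

theorem integral_hermiteHe_mul_zero (hg : IsBoundedDerivSeq g) (k : ℕ) :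
    ∫ x, hermiteHe k x * g 0 x ∂stdNormal = ∫ x, g k x ∂stdNormal := by
  have h := hg.integral_hermiteHe_add_mul 0 0 k
  simpa [hermiteHe_zero] using h

/-- Decay of the Hermite coefficients of a smooth function with bounded derivatives. -/
theorem exists_sq_integral_hermiteHe_le (hg : IsBoundedDerivSeq g) (k : ℕ) :
    ∃ M, 0 ≤ M ∧ ∀ n, (∫ x, hermiteHe (n + k) x * g 0 x ∂stdNormal) ^ 2 ≤ M * n.factorial := by
  obtain ⟨M, hM⟩ := hg.bounded (0 + k)
  refine ⟨M ^ 2, sq_nonneg _, fun n => ?_⟩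
  rw [hg.integral_hermiteHe_add_mul]
  have hle : ∀ x, |hermiteHe n x * g (0 + k) x| ≤ M * |hermiteHe n x| := fun x => by
    rw [abs_mul, mul_comm]
    exact mul_le_mul_of_nonneg_right (hM x) (abs_nonneg _)
  have hL : MemLp (fun x => hermiteHe n x * g (0 + k) x) 2 stdNormal :=
    (memLp_hermiteHe n).of_le_mul
      ((continuous_hermiteHe n).mul (hg.continuous _)).aestronglyMeasurable
      (ae_of_all _ hle)
  have hv := variance_nonneg (fun x => hermiteHe n x * g (0 + k) x) stdNormal
  rw [variance_eq_sub hL] at hv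
  have h2 : ∫ x, (hermiteHe n x * g (0 + k) x) ^ 2 ∂stdNormal ≤
      ∫ x, M ^ 2 * hermiteHe n x ^ 2 ∂stdNormal := by
    refine integral_mono hL.integrable_sq ((integrable_hermiteHe_sq n).const_mul _) fun x => ?_
    have := pow_le_pow_left₀ (abs_nonneg _) (hle x) 2
    simpa [mul_pow] using this
  rw [integral_const_mul, integral_hermiteHe_sq] at h2
  simp only [Pi.pow_apply] at hv
  linarith

/-- The difference quotient `(g y - g x) / (y - x)` is smooth with bounded derivatives. -/
theorem exists_slope (hg : IsBoundedDerivSeq g) (x : ℝ) :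
    ∃ G : ℕ → ℝ → ℝ, IsBoundedDerivSeq G ∧ ∀ y, g 0 y = g 0 x + (y - x) * G 0 y := by
  have hc : ∀ k y, Continuous fun t : ℝ => t ^ k * g (k + 1) (x + t * (y - x)) := fun k y => by
    have := hg.continuous (k + 1)
    fun_prop
  refine ⟨fun k y => ∫ t in (0 : ℝ)..1, t ^ k * g (k + 1) (x + t * (y - x)), ⟨?_, ?_⟩, ?_⟩
  · intro k y
    obtain ⟨M, hM⟩ := hg.bounded (k + 2)
    refine (intervalIntegral.hasDerivAt_integral_of_dominated_loc_of_deriv_le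
      (F := fun y t => t ^ k * g (k + 1) (x + t * (y - x)))
      (F' := fun y t => t ^ (k + 1) * g (k + 2) (x + t * (y - x)))
      (bound := fun _ => M) univ_mem (Eventually.of_forall fun z => (hc k z).aestronglyMeasurable)
      ((hc k y).intervalIntegrable _ _) (hc (k + 1) y).aestronglyMeasurable
      (ae_of_all _ fun t ht z _ => ?_) intervalIntegrable_const
      (ae_of_all _ fun t _ z _ => ?_)).2
    · rw [Set.uIoc_of_le zero_le_one] at ht
      have h1 : t ^ (k + 1) ≤ 1 := pow_le_one₀ ht.1.le ht.2
      have h0 : 0 ≤ t ^ (k + 1) := pow_nonneg ht.1.le _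
      rw [norm_mul, norm_of_nonneg h0, norm_eq_abs]
      have := hM (x + t * (z - x))
      nlinarith [abs_nonneg (g (k + 2) (x + t * (z - x)))]
    · have hin : HasDerivAt (fun z => x + t * (z - x)) t z := by
        simpa using (((hasDerivAt_id z).sub_const x).const_mul t).const_add x
      convert! ((hg.hasDerivAt (k + 1) _).comp z hin).const_mul (t ^ k) using 1
      ring
  · intro k
    obtain ⟨M, hM⟩ := hg.bounded (k + 1)
    refine ⟨M, fun y => ?_⟩
    have := intervalIntegral.norm_integral_le_of_norm_le_const (a := 0) (b := 1) (C := M)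
      (f := fun t => t ^ k * g (k + 1) (x + t * (y - x))) fun t ht => by
        rw [Set.uIoc_of_le zero_le_one] at ht
        have h1 : t ^ k ≤ 1 := pow_le_one₀ ht.1.le ht.2
        have h0 : 0 ≤ t ^ k := pow_nonneg ht.1.le _
        rw [norm_mul, norm_of_nonneg h0, norm_eq_abs]
        have := hM (x + t * (y - x))
        nlinarith [abs_nonneg (g (k + 1) (x + t * (y - x)))]
    simpa using this
  · intro y
    have h := intervalIntegral.integral_eq_sub_of_hasDerivAt (a := 0) (b := 1)
      (f := fun t => g 0 (x + t * (y - x)))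
      (f' := fun t => (y - x) * (t ^ 0 * g (0 + 1) (x + t * (y - x))))
      (fun t _ => by
        have hin : HasDerivAt (fun t => x + t * (y - x)) (y - x) t := by
          simpa using ((hasDerivAt_id t).mul_const (y - x)).const_add x
        convert! (hg.hasDerivAt 0 _).comp t hin using 1
        ring)
      (((hc 0 y).const_mul (y - x)).intervalIntegrable _ _)
    rw [intervalIntegral.integral_const_mul] at h
    simp only [one_mul, zero_mul, add_zero, add_sub_cancel] at h
    simp only [h]
    ring

end IsBoundedDerivSeq

theorem christoffel_darboux (N : ℕ) (x y : ℝ) :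
    (∑ k ∈ Finset.range (N + 1), hermiteHe k x / k.factorial * hermiteHe k y) * (y - x) =
      (hermiteHe (N + 1) y * hermiteHe N x - hermiteHe N y * hermiteHe (N + 1) x) /
        N.factorial := by
  induction N with
  | zero => simp [hermiteHe_zero, hermiteHe_one]
  | succ N ih =>
    rw [Finset.sum_range_succ, add_mul, ih, hermiteHe_add_two, hermiteHe_add_two]
    push_cast [Nat.factorial_succ]
    field_simp
    ring

theorem sum_hermite_series (N : ℕ) {x : ℝ} {F G : ℕ → ℝ → ℝ} (hF : IsBoundedDerivSeq F)
    (hG : IsBoundedDerivSeq G) (hFG : ∀ y, F 0 y = F 0 x + (y - x) * G 0 y) :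
    ∑ k ∈ Finset.range (N + 1),
        hermiteHe k x / k.factorial * ∫ y, hermiteHe k y * F 0 y ∂stdNormal =
      F 0 x + (hermiteHe N x * ∫ y, hermiteHe (N + 1) y * G 0 y ∂stdNormal) / N.factorial -
        (hermiteHe (N + 1) x * ∫ y, hermiteHe N y * G 0 y ∂stdNormal) / N.factorial := by
  have hiF : ∀ k, Integrable (fun y => hermiteHe k y * F 0 y) stdNormal := fun k =>
    (memLp_hermiteHe k).integrable_mul (hF.memLp _ _)
  have hiG : ∀ k, Integrable (fun y => hermiteHe k y * G 0 y) stdNormal := fun k =>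
    (memLp_hermiteHe k).integrable_mul (hG.memLp _ _)
  have hi : ∀ k, Integrable (hermiteHe k) stdNormal := fun k =>
    (memLp_hermiteHe k).integrable one_le_two
  have hconst : ∑ k ∈ Finset.range (N + 1),
      hermiteHe k x / k.factorial * ∫ y, hermiteHe k y ∂stdNormal = 1 := by
    rw [Finset.sum_range_succ']
    simp [integral_hermiteHe_succ, hermiteHe_zero]
  have hmain : ∑ k ∈ Finset.range (N + 1),
      hermiteHe k x / k.factorial * ∫ y, hermiteHe k y * (F 0 y - F 0 x) ∂stdNormal =
      ∫ y, (hermiteHe N x * (hermiteHe (N + 1) y * G 0 y) -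
        hermiteHe (N + 1) x * (hermiteHe N y * G 0 y)) / N.factorial ∂stdNormal := by
    simp only [← integral_const_mul]
    rw [← integral_finsetSum]
    · refine integral_congr_ae (ae_of_all _ fun y => ?_)
      have h := congrArg (· * G 0 y) (christoffel_darboux N x y)
      have e : F 0 y - F 0 x = (y - x) * G 0 y := by rw [hFG y]; ring
      simp only [e] at h ⊢
      simp only [← mul_assoc, ← Finset.sum_mul]
      rw [h]
      ring
    · intro k _
      refine Integrable.const_mul ?_ _
      simp only [mul_sub]
      exact (hiF k).sub ((hi k).mul_const _)
  have hsplit : ∀ k, ∫ y, hermiteHe k y * (F 0 y - F 0 x) ∂stdNormal =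
      ∫ y, hermiteHe k y * F 0 y ∂stdNormal - (∫ y, hermiteHe k y ∂stdNormal) * F 0 x := by
    intro k
    simp only [mul_sub]
    rw [integral_sub (hiF k) ((hi k).mul_const _), integral_mul_const]
  simp only [hsplit] at hmain
  simp only [mul_sub, Finset.sum_sub_distrib, ← mul_assoc, ← Finset.sum_mul, hconst] at hmain
  simp only [mul_assoc] at hmain
  rw [integral_div, integral_sub ((hiG _).const_mul _) ((hiG _).const_mul _), integral_const_mul,
    integral_const_mul] at hmain
  rw [sub_eq_iff_eq_add.1 hmain]
  ring

theorem abs_mul_div_le_of_sq_le {a c d A B R : ℝ} (ha : a ^ 2 ≤ A) (hc : c ^ 2 ≤ B) (hd : 0 < d)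
    (hR : 0 ≤ R) (h : A * B ≤ (R * d) ^ 2) : |a * c / d| ≤ R := by
  rw [abs_div, abs_of_pos hd, div_le_iff₀ hd]
  refine abs_le_of_sq_le_sq ?_ (by positivity)
  rw [mul_pow]
  exact (mul_le_mul ha hc (sq_nonneg _) ((sq_nonneg _).trans ha)).trans h

/-- Pointwise convergence of the Hermite expansion of a smooth function with bounded
derivatives. -/
theorem IsBoundedDerivSeq.hasSum_hermiteHe {F : ℕ → ℝ → ℝ} (hF : IsBoundedDerivSeq F) (x : ℝ) :
    HasSum (fun k : ℕ => hermiteHe k x / k.factorial * ∫ y, hermiteHe k y * F 0 y ∂stdNormal)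
      (F 0 x) := by
  obtain ⟨G, hG, hFG⟩ := hF.exists_slope x
  obtain ⟨C, hC0, hC⟩ : ∃ C, 0 ≤ C ∧
      ∀ n : ℕ, hermiteHe n x ^ 2 ≤ C * ((n + 2) * n.factorial) := by
    have hp := gaussianPDFReal_pos 0 1 x one_ne_zero
    refine ⟨(gaussianPDFReal 0 1 x)⁻¹, (inv_pos.2 hp).le, fun n => ?_⟩
    rw [inv_mul_eq_div, le_div_iff₀' hp]
    exact gaussianPDFReal_mul_hermiteHe_sq_le n x
  have hsum : Summable fun k : ℕ =>
      hermiteHe k x / k.factorial * ∫ y, hermiteHe k y * F 0 y ∂stdNormal := by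
    obtain ⟨M, hM0, hM⟩ := hF.exists_sq_integral_hermiteHe_le 5
    rw [← summable_nat_add_iff 5]
    have h2 : Summable fun n : ℕ => √(7 * C * M) * (1 / ((n + 1 : ℕ) : ℝ) ^ 2) :=
      ((summable_nat_add_iff 1).2 (Real.summable_one_div_nat_pow.2 one_lt_two)).mul_left _
    refine h2.of_norm_bounded fun n => ?_
    rw [norm_eq_abs, div_mul_eq_mul_div]
    refine abs_mul_div_le_of_sq_le (hC _) (hM _) (by positivity) (by positivity) ?_
    rw [mul_pow, mul_pow, sq_sqrt (by positivity)]
    push_cast [Nat.factorial_succ]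
    have hn : (0 : ℝ) ≤ n := n.cast_nonneg
    have hpoly : ((n : ℝ) + 7) * ((n : ℝ) + 1) ^ 4 ≤
        7 * (((n : ℝ) + 5) * (n + 4) * (n + 3) * (n + 2) * (n + 1)) := by
      rw [← sub_nonneg]
      ring_nf
      positivity
    calc _ = C * M * (n.factorial : ℝ) ^ 2 * (((n : ℝ) + 5) * (n + 4) * (n + 3) * (n + 2) * (n + 1)) * (((n : ℝ) + 7)) := by ring
      _ ≤ C * M * (n.factorial : ℝ) ^ 2 * (((n : ℝ) + 5) * (n + 4) * (n + 3) * (n + 2) * (n + 1)) *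
          (7 * (((n : ℝ) + 5) * (n + 4) * (n + 3) * (n + 2) * (n + 1)) / ((n : ℝ) + 1) ^ 4) := by
        gcongr
        rwa [le_div_iff₀ (by positivity)]
      _ = _ := by field
  rw [hsum.hasSum_iff_tendsto_nat, ← tendsto_add_atTop_iff_nat 5]
  simp only [fun n : ℕ => show n + 5 = (n + 4) + 1 from rfl, sum_hermite_series _ hF hG hFG]
  have hz : Tendsto (fun n : ℕ => 1 / ((n : ℝ) + 1)) atTop (𝓝 0) :=
    tendsto_one_div_add_atTop_nhds_zero_nat
  have t1 : Tendsto (fun n : ℕ => (hermiteHe (n + 4) x *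
      ∫ y, hermiteHe (n + 5) y * G 0 y ∂stdNormal) / ((n + 4).factorial : ℝ)) atTop (𝓝 0) := by
    obtain ⟨M, hM0, hM⟩ := hG.exists_sq_integral_hermiteHe_le 5
    refine squeeze_zero_norm (fun n => ?_) (by simpa using hz.const_mul √(6 * C * M))
    refine abs_mul_div_le_of_sq_le (hC _) (hM _) (by positivity) (by positivity) ?_
    rw [mul_pow, mul_pow, sq_sqrt (by positivity)]
    push_cast [Nat.factorial_succ]
    have hn : (0 : ℝ) ≤ n := n.cast_nonneg
    have hpoly : ((n : ℝ) + 6) * ((n : ℝ) + 1) ^ 2 ≤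
        6 * (((n : ℝ) + 4) * (n + 3) * (n + 2) * (n + 1)) := by
      rw [← sub_nonneg]
      ring_nf
      positivity
    calc _ = C * M * (n.factorial : ℝ) ^ 2 * (((n : ℝ) + 4) * (n + 3) * (n + 2) * (n + 1)) * (((n : ℝ) + 6)) := by ring
      _ ≤ C * M * (n.factorial : ℝ) ^ 2 * (((n : ℝ) + 4) * (n + 3) * (n + 2) * (n + 1)) *
          (6 * (((n : ℝ) + 4) * (n + 3) * (n + 2) * (n + 1)) / ((n : ℝ) + 1) ^ 2) := by
        gcongr
        rwa [le_div_iff₀ (by positivity)]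
      _ = _ := by field
  have t2 : Tendsto (fun n : ℕ => (hermiteHe (n + 5) x *
      ∫ y, hermiteHe (n + 4) y * G 0 y ∂stdNormal) / ((n + 4).factorial : ℝ)) atTop (𝓝 0) := by
    obtain ⟨M, hM0, hM⟩ := hG.exists_sq_integral_hermiteHe_le 4
    refine squeeze_zero_norm (fun n => ?_) (by simpa using hz.const_mul √(35 * C * M))
    refine abs_mul_div_le_of_sq_le (hC _) (hM _) (by positivity) (by positivity) ?_
    rw [mul_pow, mul_pow, sq_sqrt (by positivity)]
    push_cast [Nat.factorial_succ]
    have hn : (0 : ℝ) ≤ n := n.cast_nonneg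
    have hpoly : ((n : ℝ) + 7) * (n + 5) * ((n : ℝ) + 1) ^ 2 ≤
        35 * (((n : ℝ) + 4) * (n + 3) * (n + 2) * (n + 1)) := by
      rw [← sub_nonneg]
      ring_nf
      positivity
    calc _ = C * M * (n.factorial : ℝ) ^ 2 * (((n : ℝ) + 4) * (n + 3) * (n + 2) * (n + 1)) * (((n : ℝ) + 7) * (n + 5)) := by ring
      _ ≤ C * M * (n.factorial : ℝ) ^ 2 * (((n : ℝ) + 4) * (n + 3) * (n + 2) * (n + 1)) *
          (35 * (((n : ℝ) + 4) * (n + 3) * (n + 2) * (n + 1)) / ((n : ℝ) + 1) ^ 2) := by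
        gcongr
        rwa [le_div_iff₀ (by positivity)]
      _ = _ := by field
  simpa using (tendsto_const_nhds.add t1).sub t2

theorem hermiteH_eq_hermiteHe (j : ℕ) (z : ℝ) : hermiteH j z = √2 ^ j * hermiteHe j (√2 * z) := by
  have e : (fun t : ℝ => exp (-t ^ 2)) =
      fun t => (fun y : ℝ => exp (-(y ^ 2 / 2))) (√2 * t) := by
    ext t
    simp [mul_pow]
  have hw : ContDiff ℝ j fun y : ℝ => exp (-(y ^ 2 / 2)) := by fun_prop
  rw [hermiteH, e, iteratedDeriv_comp_const_mul hw, iteratedDeriv_eq_iterate]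
  beta_reduce
  rw [Polynomial.deriv_gaussian_eq_hermite_mul_gaussian, hermiteHe]
  have h1 : exp (z ^ 2) * exp (-((√2 * z) ^ 2 / 2)) = 1 := by
    rw [← exp_add]
    simp [mul_pow]
  have h2 : ((-1 : ℝ) ^ j) * (-1) ^ j = 1 := by rw [← mul_pow]; simp
  linear_combination (√2 ^ j * Polynomial.aeval (√2 * z) (Polynomial.hermite j)) *
    (h2 * (exp (z ^ 2) * exp (-((√2 * z) ^ 2 / 2))) + h1)

/-- Integration against the heat kernel at time `b`, as an integral against the standard
Gaussian. -/
theorem integral_heatKernel_mul {b : ℝ} (hb : 0 < b) (φ : ℝ → ℝ) :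
    ∫ ξ, exp (-ξ ^ 2 / (4 * b)) / (2 * √(π * b)) * φ ξ = ∫ y, φ (√(2 * b) * y) ∂stdNormal := by
  have hc : 0 < √(2 * b) := by positivity
  have hpdf : ∀ y, gaussianPDFReal 0 1 y =
      √(2 * b) * (exp (-(√(2 * b) * y) ^ 2 / (4 * b)) / (2 * √(π * b))) := by
    intro y
    have h4 : √(2 * π) * √(2 * b) = 2 * √(π * b) := by
      rw [← sqrt_mul (by positivity), show 2 * π * (2 * b) = 2 ^ 2 * (π * b) by ring,
        sqrt_mul (by positivity), sqrt_sq (by norm_num)]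
    rw [← h4, mul_pow, sq_sqrt (by positivity), gaussianPDFReal]
    have e : -(2 * b * y ^ 2) / (4 * b) = -y ^ 2 / 2 := by
      field_simp
      ring
    rw [e]
    simp only [NNReal.coe_one, mul_one, sub_zero]
    field_simp
  rw [integral_gaussianReal_eq_integral_smul one_ne_zero]
  simp only [hpdf, smul_eq_mul, mul_assoc]
  rw [integral_const_mul, Measure.integral_comp_mul_left
    (fun ξ => exp (-ξ ^ 2 / (4 * b)) / (2 * √(π * b)) * φ ξ), abs_of_pos (inv_pos.2 hc),
    smul_eq_mul, mul_inv_cancel_left₀ hc.ne']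

theorem integral_integral_stdNormal {h : ℝ → ℝ} (hh : Continuous h) {M : ℝ}
    (hM : ∀ x, |h x| ≤ M) {a b c : ℝ} (habc : a ^ 2 = b ^ 2 + c ^ 2) :
    ∫ t, ∫ z, h (b * z + c * t) ∂stdNormal ∂stdNormal = ∫ y, h (a * y) ∂stdNormal := by
  have hconv : (stdNormal.map (c * ·)) ∗ (stdNormal.map (b * ·)) = stdNormal.map (a * ·) := by
    simp only [gaussianReal_map_const_mul, gaussianReal_conv_gaussianReal]
    congr 1
    · simp
    · ext
      simp [habc, add_comm]
  have hint : ∀ μ : Measure ℝ, IsFiniteMeasure μ → Integrable h μ := fun μ _ =>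
    (memLp_of_bounded hh hM μ).integrable one_le_two
  have hm : ∀ d : ℝ, AEMeasurable (d * ·) stdNormal := fun d => by fun_prop
  have : ∀ d : ℝ, IsProbabilityMeasure (stdNormal.map (d * ·)) := fun d =>
    Measure.isProbabilityMeasure_map (hm d)
  rw [← integral_map (hm a) hh.aestronglyMeasurable, ← hconv, integral_conv (hint _ inferInstance)]
  rw [integral_map (hm c)]
  · refine integral_congr_ae (ae_of_all _ fun t => ?_)
    simp only
    rw [integral_map (hm b) (by fun_prop)]
    simp only [add_comm]
  · exact ((hint ((stdNormal.map (c * ·)) ∗ (stdNormal.map (b * ·)))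
      inferInstance).comp_measurable measurable_add).integral_prod_left.aestronglyMeasurable

theorem IsBoundedDerivSeq.comp_mul_add {g : ℕ → ℝ → ℝ} (hg : IsBoundedDerivSeq g) (c d : ℝ) :
    IsBoundedDerivSeq fun k y => c ^ k * g k (c * y + d) where
  hasDerivAt k y := by
    have hin : HasDerivAt (fun y => c * y + d) c y := by
      simpa using ((hasDerivAt_id y).const_mul c).add_const d
    convert! ((hg.hasDerivAt k _).comp y hin).const_mul (c ^ k) using 1
    ring
  bounded k := by
    obtain ⟨M, hM⟩ := hg.bounded k
    refine ⟨|c ^ k| * M, fun y => ?_⟩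
    rw [abs_mul]
    exact mul_le_mul_of_nonneg_left (hM _) (abs_nonneg _)

theorem isBoundedDerivSeq_iteratedDeriv {f : ℝ → ℝ} (hf : ContDiff ℝ (⊤ : ℕ∞) f)
    (hsupp : HasCompactSupport f) : IsBoundedDerivSeq fun k => iteratedDeriv k f where
  hasDerivAt k x := by
    rw [iteratedDeriv_succ]
    exact (hf.differentiable_iteratedDeriv k (by exact_mod_cast ENat.natCast_lt_top k) x).hasDerivAt
  bounded k := by
    have hs : HasCompactSupport (iteratedDeriv k f) := by
      induction k with
      | zero => simpa using hsupp
      | succ k ih => rw [iteratedDeriv_succ]; exact ih.deriv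
    obtain ⟨M, hM⟩ := hs.exists_bound_of_continuous
      (hf.continuous_iteratedDeriv k (by exact_mod_cast le_top))
    exact ⟨M, hM⟩

/-- The Hermite coefficients of a Gaussian average are those of the rescaled function. -/
theorem IsBoundedDerivSeq.integral_hermiteHe_mul_integral {g : ℕ → ℝ → ℝ}
    (hg : IsBoundedDerivSeq g) {a b c : ℝ} (habc : a ^ 2 = b ^ 2 + c ^ 2) (j : ℕ) :
    a ^ j * ∫ z, hermiteHe j z * ∫ t, g 0 (b * z + c * t) ∂stdNormal ∂stdNormal =
      b ^ j * ∫ y, hermiteHe j y * g 0 (a * y) ∂stdNormal := by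
  obtain ⟨M, hM⟩ := hg.bounded 0
  obtain ⟨M', hM'⟩ := hg.bounded j
  have hinner : ∀ d e : ℝ, ∫ z, hermiteHe j z * g 0 (d * z + e) ∂stdNormal =
      d ^ j * ∫ z, g j (d * z + e) ∂stdNormal := fun d e => by
    simpa [integral_const_mul] using (hg.comp_mul_add d e).integral_hermiteHe_mul_zero j
  have hswap : ∫ z, hermiteHe j z * ∫ t, g 0 (b * z + c * t) ∂stdNormal ∂stdNormal =
      ∫ t, ∫ z, hermiteHe j z * g 0 (b * z + c * t) ∂stdNormal ∂stdNormal := by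
    simp only [← integral_const_mul]
    refine integral_integral_swap ?_
    have h1 : Integrable (fun p : ℝ × ℝ => hermiteHe j p.1) (stdNormal.prod stdNormal) :=
      ((memLp_hermiteHe j).integrable one_le_two).comp_fst _
    refine h1.mul_bdd (c := M) ?_ (ae_of_all _ fun p => hM _)
    have := hg.continuous 0
    exact Continuous.aestronglyMeasurable (by fun_prop)
  rw [hswap]
  simp only [hinner, integral_const_mul]
  rw [integral_integral_stdNormal (hg.continuous j) hM' habc]
  have := hinner a 0
  simp only [add_zero] at this
  rw [this]
  ring

/-- Second Hermite-series reconstruction formula for the inverse Cauchy problem of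
the heat equation: if `u(τ,·)` is the temperature field at time `τ` obtained from
a smooth, compactly supported initial field `f`, then for every `x` the series
`∑_j (1/(2√β))^j H_j(x/(2√(τ+β))) ((τ+β)^{j/2}/j!) u_j` converges to `f(x)`,
where `u_j = ∫ (e^{−ξ²/(4β)}/(2√(πβ))) H_j(ξ/(2√β)) u(τ,ξ) dξ`. -/
theorem inverse_heat_hermite_series' (f : ℝ → ℝ) (hf : ContDiff ℝ (⊤ : ℕ∞) f)
    (hsupp : HasCompactSupport f) (τ β : ℝ) (hτ : 0 < τ) (hβ : 0 < β)
    (u : ℝ → ℝ)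
    (hu : ∀ ξ : ℝ, u ξ =
      (1 / (2 * Real.sqrt (Real.pi * τ))) * ∫ η : ℝ, Real.exp (-(ξ - η) ^ 2 / (4 * τ)) * f η)
    (x : ℝ) :
    HasSum
      (fun j : ℕ =>
        (1 / (2 * Real.sqrt β)) ^ j * hermiteH j (x / (2 * Real.sqrt (τ + β))) *
          ((τ + β) ^ ((j : ℝ) / 2) / (j.factorial : ℝ)) *
          ∫ ξ : ℝ,
            Real.exp (-ξ ^ 2 / (4 * β)) / (2 * Real.sqrt (Real.pi * β)) *
              hermiteH j (ξ / (2 * Real.sqrt β)) * u ξ)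
      (f x) := by
  have hg := isBoundedDerivSeq_iteratedDeriv hf hsupp
  have hs : 0 < τ + β := by positivity
  have ha : 0 < √(2 * (τ + β)) := by positivity
  have hu' : ∀ ξ, u ξ = ∫ t, f (ξ + √(2 * τ) * t) ∂stdNormal := fun ξ => by
    rw [hu, ← integral_heatKernel_mul hτ fun t => f (ξ + t),
      ← integral_add_left_eq_self _ ξ, ← integral_const_mul]
    refine integral_congr_ae (ae_of_all _ fun t => ?_)
    simp only [sub_add_cancel_left, neg_sq]
    ring
  have hs2 : ∀ r : ℝ, √(2 * r) = √2 * √r := fun r => sqrt_mul zero_le_two r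
  have h22 : √2 * √2 = 2 := mul_self_sqrt zero_le_two
  have key := (hg.comp_mul_add √(2 * (τ + β)) 0).hasSum_hermiteHe (x / √(2 * (τ + β)))
  simp only [pow_zero, one_mul, add_zero, iteratedDeriv_zero, mul_div_cancel₀ x ha.ne'] at key
  refine key.congr_fun fun j => ?_
  have hcoef := hg.integral_hermiteHe_mul_integral (a := √(2 * (τ + β))) (b := √(2 * β))
    (c := √(2 * τ)) (by
      rw [sq_sqrt (by positivity), sq_sqrt (by positivity), sq_sqrt (by positivity)]; ring) j
  simp only [iteratedDeriv_zero] at hcoef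
  simp only [mul_assoc (exp _ / _)]
  rw [integral_heatKernel_mul hβ fun ξ => hermiteH j (ξ / (2 * √β)) * u ξ]
  have harg : ∀ y, √2 * (√(2 * β) * y / (2 * √β)) = y := fun y => by
    rw [hs2]
    have := sqrt_pos.2 hβ
    field_simp
    linear_combination y * h22
  have harg' : √2 * (x / (2 * √(τ + β))) = x / √(2 * (τ + β)) := by
    rw [hs2]
    have := sqrt_pos.2 hs
    field_simp
    linear_combination x * h22
  simp only [hermiteH_eq_hermiteHe, harg, harg', hu', mul_assoc, integral_const_mul]
  have hrpow : (τ + β) ^ ((j : ℝ) / 2) = √(τ + β) ^ j := by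
    rw [sqrt_eq_rpow, ← rpow_natCast, ← rpow_mul hs.le]
    congr 1
    ring
  rw [hrpow]
  have hB : 0 < √β := sqrt_pos.2 hβ
  have hS : 0 < √(τ + β) := sqrt_pos.2 hs
  have h2 : 0 < √(2 : ℝ) := sqrt_pos.2 zero_lt_two
  have hE : (2 : ℝ) ^ j = √2 ^ j * √2 ^ j := by rw [← mul_pow, h22]
  simp only [hs2] at hcoef ⊢
  rw [mul_pow, mul_pow, mul_assoc, mul_assoc,
    mul_right_inj' (pow_ne_zero j h2.ne')] at hcoef
  generalize ∫ z, hermiteHe j z * ∫ t, f (√2 * √β * z + √2 * √τ * t) ∂stdNormal ∂stdNormal = I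
    at hcoef ⊢
  rw [one_div, inv_pow, mul_pow, hE]
  field_simp
  linear_combination hermiteHe j (x / (√2 * √(τ + β))) * hcoef
end
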